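/- Let φ: ℝᵐ → ℝ ∪ {+∞} be proper, lower semicontinuous and convex, and let c > 0. Then for every z ∈ ℝᵐ, every matrix G belonging to the Clarke generalized Jacobian ∂prox_{φ/c}(z) is symmetric positive semidefinite with operator norm ‖G‖ ≤ 1. (In particular, at every point z where prox_{φ/c} is differentiable, its Jacobian is symmetric positive semidefinite with norm at most 1.) -/

import Mathlib

noncomputable section

open Filter Set Topology
open scoped RealInnerProductSpace

/-- Euclidean space `ℝⁿ`. -/
abbrev En (n : ℕ) : Type := EuclideanSpace ℝ (Fin n)

/-- `φ` is a proper, lower semicontinuous (closed), convex extended-real-valued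
function. -/
def ProperLscConvex {V : Type*} [NormedAddCommGroup V] [NormedSpace ℝ V]
    (φ : V → EReal) : Prop :=
  (∀ z, φ z ≠ ⊥) ∧ (∃ z, φ z ≠ ⊤) ∧ LowerSemicontinuous φ ∧
    ∀ z w : V, ∀ a b : ℝ, 0 ≤ a → 0 ≤ b → a + b = 1 →
      φ (a • z + b • w) ≤ (a : EReal) * φ z + (b : EReal) * φ w

/-- The convex (Fenchel) conjugate `φ*`. -/
def econj {m : ℕ} (φ : En m → EReal) : En m → EReal :=
  fun y => ⨆ z : En m, (⟪y, z⟫ : EReal) - φ z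

/-- The effective domain of an extended-real-valued function. -/
def edom {V : Type*} (g : V → EReal) : Set V := {z | g z ≠ ⊤}

/-- `p` is the proximal operator `prox_{φ/c}`: for every `z`, `p z` is the unique
minimizer of `u ↦ φ(u) + (c/2)‖u - z‖²`. -/
def IsProx {m : ℕ} (φ : En m → EReal) (c : ℝ) (p : En m → En m) : Prop :=
  ∀ z : En m,
    (∀ u : En m,
      φ (p z) + ((c / 2 * ‖p z - z‖ ^ 2 : ℝ) : EReal)
        ≤ φ u + ((c / 2 * ‖u - z‖ ^ 2 : ℝ) : EReal)) ∧
    ∀ u : En m,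
      (∀ v : En m,
        φ u + ((c / 2 * ‖u - z‖ ^ 2 : ℝ) : EReal)
          ≤ φ v + ((c / 2 * ‖v - z‖ ^ 2 : ℝ) : EReal)) → u = p z

/-- The Moreau envelope `φ_c` (expressed through the proximal operator `p`). -/
def menv {m : ℕ} (φ : En m → EReal) (c : ℝ) (p : En m → En m) (z : En m) : ℝ :=
  (φ (p z)).toReal + c / 2 * ‖p z - z‖ ^ 2

/-- The Moreau envelope as an extended-real-valued infimum. -/
def menvE {m : ℕ} (φ : En m → EReal) (c : ℝ) (z : En m) : EReal :=
  ⨅ u : En m, φ u + ((c / 2 * ‖u - z‖ ^ 2 : ℝ) : EReal)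

/-- The augmented Lagrangian `L_c(x,λ) = f(x) + φ_c(Ex + λ/c) - ‖λ‖²/(2c)`. -/
def AL {n m : ℕ} (f : En n → ℝ) (φ : En m → EReal) (c : ℝ) (p : En m → En m)
    (E : En n →L[ℝ] En m) (x : En n) (lam : En m) : ℝ :=
  f x + menv φ c p (E x + c⁻¹ • lam) - ‖lam‖ ^ 2 / (2 * c)

/-- The ordinary Lagrangian `L(x,λ) = f(x) - φ*(λ) + ⟨λ, Ex⟩`. -/
def Lag {n m : ℕ} (f : En n → ℝ) (φ : En m → EReal) (E : En n →L[ℝ] En m)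
    (x : En n) (lam : En m) : EReal :=
  ((f x + ⟪lam, E x⟫ : ℝ) : EReal) - econj φ lam

/-- The primal objective of problem (P). -/
def Pv {n m : ℕ} (f : En n → ℝ) (φ : En m → EReal) (E : En n →L[ℝ] En m)
    (x : En n) : EReal :=
  ((f x : ℝ) : EReal) + φ (E x)

/-- The dual objective of problem (D): `-f*(-Eᵀλ) - φ*(λ)`. -/
def Dv {n m : ℕ} (f : En n → ℝ) (φ : En m → EReal) (E : En n →L[ℝ] En m)
    (lam : En m) : EReal :=
  - (econj (fun x : En n => ((f x : ℝ) : EReal)) (-(ContinuousLinearMap.adjoint E lam))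
      + econj φ lam)

/-- Saddle point of an extended-real-valued Lagrangian. -/
def IsSaddle {n m : ℕ} (L : En n → En m → EReal) (xb : En n) (lb : En m) : Prop :=
  ∀ (x : En n) (lam : En m), L xb lam ≤ L xb lb ∧ L xb lb ≤ L x lb

/-- `g` is a subgradient of the extended-real-valued convex function `h` at `z`. -/
def ESubgradAt {m : ℕ} (h : En m → EReal) (g : En m) (z : En m) : Prop :=
  ∀ y : En m, h z + ((⟪g, y - z⟫ : ℝ) : EReal) ≤ h y

/-- Closed form of the `x`-gradient of the augmented Lagrangian:
`∇f(x) + cEᵀ(Ex + λ/c - prox_{φ/c}(Ex + λ/c))`. -/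
def gradALx {n m : ℕ} (f : En n → ℝ) (c : ℝ) (p : En m → En m)
    (E : En n →L[ℝ] En m) (lam : En m) (x : En n) : En n :=
  gradient f x +
    c • (ContinuousLinearMap.adjoint E) (E x + c⁻¹ • lam - p (E x + c⁻¹ • lam))

/-- The regularized objective `ψ(ξ) = L_c(ξ,λ) + (1/(2c))‖ξ - x‖²`. -/
def psiFun {n m : ℕ} (f : En n → ℝ) (φ : En m → EReal) (c : ℝ) (p : En m → En m)
    (E : En n →L[ℝ] En m) (x : En n) (lam : En m) (ξ : En n) : ℝ :=
  AL f φ c p E ξ lam + 1 / (2 * c) * ‖ξ - x‖ ^ 2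

/-- Closed form of `∇ψ`. -/
def gradPsi {n m : ℕ} (f : En n → ℝ) (c : ℝ) (p : En m → En m)
    (E : En n →L[ℝ] En m) (x : En n) (lam : En m) (ξ : En n) : En n :=
  gradALx f c p E lam ξ + c⁻¹ • (ξ - x)

/-- Limiting (B-) Jacobian: limits of Jacobians along sequences of points of
differentiability. -/
def limJac {a b : ℕ} (Φ : En a → En b) (x : En a) : Set (En a →L[ℝ] En b) :=
  {G | ∃ u : ℕ → En a, (∀ k, DifferentiableAt ℝ Φ (u k)) ∧
        Tendsto u atTop (𝓝 x) ∧ Tendsto (fun k => fderiv ℝ Φ (u k)) atTop (𝓝 G)}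

/-- Clarke generalized Jacobian. -/
def clarkeJac {a b : ℕ} (Φ : En a → En b) (x : En a) : Set (En a →L[ℝ] En b) :=
  convexHull ℝ (limJac Φ x)

/-- Symmetry (self-adjointness) of a continuous linear operator. -/
def SymCLM {k : ℕ} (A : En k →L[ℝ] En k) : Prop :=
  ∀ u v : En k, ⟪A u, v⟫ = ⟪u, A v⟫

/-- Loewner order `A ⪯ B`. -/
def Loew {k : ℕ} (A B : En k →L[ℝ] En k) : Prop :=
  ∀ d : En k, ⟪d, A d⟫ ≤ ⟪d, B d⟫

/-- The set `T(ξ)` of generalized Hessians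
`∇²f(ξ) + c⁻¹I + cEᵀ(I - G)E`, `G ∈ ∂prox_{φ/c}(Eξ + λ/c)`. -/
def Tset {n m : ℕ} (f : En n → ℝ) (c : ℝ) (p : En m → En m) (E : En n →L[ℝ] En m)
    (lam : En m) (ξ : En n) : Set (En n →L[ℝ] En n) :=
  {V | ∃ G ∈ clarkeJac p (E ξ + c⁻¹ • lam),
      V = fderiv ℝ (gradient f) ξ + c⁻¹ • ContinuousLinearMap.id ℝ (En n) +
          c • ((ContinuousLinearMap.adjoint E).comp
                ((ContinuousLinearMap.id ℝ (En m) - G).comp E))}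

/-- One-sided directional differentiability. -/
def DirDiffAt {a b : ℕ} (Φ : En a → En b) (y d : En a) : Prop :=
  ∃ D : En b, Tendsto (fun t : ℝ => t⁻¹ • (Φ (y + t • d) - Φ y)) (𝓝[>] (0 : ℝ)) (𝓝 D)

/-- Semismoothness at a point. -/
def SemismoothAt {a b : ℕ} (Φ : En a → En b) (xb : En a) : Prop :=
  LocallyLipschitz Φ ∧ (∀ᶠ y in 𝓝 xb, ∀ d, DirDiffAt Φ y d) ∧
    ∀ ε > 0, ∃ δ > 0, ∀ x : En a, x ≠ xb → ‖x - xb‖ < δ →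
      ∀ G ∈ clarkeJac Φ x, ‖Φ x + G (xb - x) - Φ xb‖ ≤ ε * ‖x - xb‖

/-- Strong semismoothness at a point. -/
def StronglySemismoothAt {a b : ℕ} (Φ : En a → En b) (xb : En a) : Prop :=
  LocallyLipschitz Φ ∧ (∀ᶠ y in 𝓝 xb, ∀ d, DirDiffAt Φ y d) ∧
    ∃ C : ℝ, ∃ δ > 0, ∀ x : En a, ‖x - xb‖ < δ →
      ∀ G ∈ clarkeJac Φ x, ‖Φ x + G (xb - x) - Φ xb‖ ≤ C * ‖x - xb‖ ^ 2

/-- Linear Newton approximation (LNA) scheme of `Φ` at `xb`. -/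
def IsLNAAt {a : ℕ} (S : En a → Set (En a →L[ℝ] En a)) (Φ : En a → En a)
    (xb : En a) : Prop :=
  (∀ η, (S η).Nonempty ∧ IsCompact (S η)) ∧
  (∀ U : Set (En a →L[ℝ] En a), IsOpen U → S xb ⊆ U → ∀ᶠ η in 𝓝 xb, S η ⊆ U) ∧
  ∀ ε > 0, ∃ δ > 0, ∀ η : En a, η ≠ xb → ‖η - xb‖ < δ →
    ∀ H ∈ S η, ‖Φ η + H (xb - η) - Φ xb‖ ≤ ε * ‖η - xb‖

/-- Strong linear Newton approximation scheme of `Φ` at `xb`. -/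
def IsStrongLNAAt {a : ℕ} (S : En a → Set (En a →L[ℝ] En a)) (Φ : En a → En a)
    (xb : En a) : Prop :=
  (∀ η, (S η).Nonempty ∧ IsCompact (S η)) ∧
  (∀ U : Set (En a →L[ℝ] En a), IsOpen U → S xb ⊆ U → ∀ᶠ η in 𝓝 xb, S η ⊆ U) ∧
  ∃ C : ℝ, ∃ δ > 0, ∀ η : En a, ‖η - xb‖ < δ →
    ∀ H ∈ S η, ‖Φ η + H (xb - η) - Φ xb‖ ≤ C * ‖η - xb‖ ^ 2

/-- The Armijo condition with parameters `γ, ρ` at trial exponent `i`. -/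
def ArmijoCond {n m : ℕ} (f : En n → ℝ) (φ : En m → EReal) (c : ℝ) (p : En m → En m)
    (E : En n →L[ℝ] En m) (x : En n) (lam : En m) (γ ρ : ℝ)
    (ξl dl : En n) (i : ℕ) : Prop :=
  psiFun f φ c p E x lam (ξl + ρ ^ i • dl)
    ≤ psiFun f φ c p E x lam ξl + γ * ρ ^ i * ⟪gradPsi f c p E x lam ξl, dl⟫

theorem prox_fin {m : ℕ} {φ : En m → EReal} (hφ : ProperLscConvex φ)
    {c : ℝ} {p : En m → En m} (hp : IsProx φ c p) (z : En m) :
    φ (p z) = (((φ (p z)).toReal : ℝ) : EReal) := by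
  obtain ⟨hbot, ⟨u, hu⟩, -, -⟩ := hφ
  refine (EReal.coe_toReal ?_ (hbot _)).symm
  intro htop
  have h := (hp z).1 u
  rw [htop, EReal.top_add_coe, top_le_iff] at h
  exact (EReal.add_ne_top hu (EReal.coe_ne_top _)) h

theorem prox_opt {m : ℕ} {φ : En m → EReal} (hφ : ProperLscConvex φ)
    {c : ℝ} {p : En m → En m} (hp : IsProx φ c p) (z w : En m) :
    (φ (p z)).toReal + c / 2 * ‖p z - z‖ ^ 2 ≤ (φ (p w)).toReal + c / 2 * ‖p w - z‖ ^ 2 := by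
  have h := (hp z).1 (p w)
  rw [prox_fin hφ hp z, prox_fin hφ hp w] at h
  exact_mod_cast h

theorem prox_opt_seg {m : ℕ} {φ : En m → EReal} (hφ : ProperLscConvex φ)
    {c : ℝ} {p : En m → En m} (hp : IsProx φ c p) (z w : En m) (t : ℝ) (h0 : 0 ≤ t) (h1 : t ≤ 1) :
    (φ (p z)).toReal + c / 2 * ‖p z - z‖ ^ 2 ≤
      (1 - t) * (φ (p z)).toReal + t * (φ (p w)).toReal
        + c / 2 * ‖((1 - t) • p z + t • p w) - z‖ ^ 2 := by
  have h := (hp z).1 ((1 - t) • p z + t • p w)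
  have h2 := hφ.2.2.2 (p z) (p w) (1 - t) t (by linarith) h0 (by ring)
  have h3 := h.trans (add_le_add_left h2 _)
  rw [prox_fin hφ hp z, prox_fin hφ hp w] at h3
  exact_mod_cast h3

theorem prox_sub {m : ℕ} {φ : En m → EReal} (hφ : ProperLscConvex φ)
    {c : ℝ} (hc : 0 < c) {p : En m → En m} (hp : IsProx φ c p) (z w : En m) :
    (φ (p z)).toReal - (φ (p w)).toReal ≤ c * ⟪p z - z, p w - p z⟫ := by
  have key : ∀ t : ℝ, 0 < t → t ≤ 1 → (φ (p z)).toReal - (φ (p w)).toReal ≤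
      c * ⟪p z - z, p w - p z⟫ + t * (c / 2 * ‖p w - p z‖ ^ 2) := by
    intro t h0 h1
    have h := prox_opt_seg hφ hp z w t h0.le h1
    have e : ((1 - t) • p z + t • p w) - z = (p z - z) + t • (p w - p z) := by module
    rw [e, norm_add_sq_real, inner_smul_right, norm_smul, mul_pow, Real.norm_eq_abs, sq_abs] at h
    refine le_of_mul_le_mul_left ?_ h0
    linarith
  have hT : Tendsto (fun t : ℝ => c * ⟪p z - z, p w - p z⟫ + t * (c / 2 * ‖p w - p z‖ ^ 2))
      (𝓝[>] 0) (𝓝 (c * ⟪p z - z, p w - p z⟫ + 0 * (c / 2 * ‖p w - p z‖ ^ 2))) := by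
    refine Tendsto.mono_left (Continuous.tendsto (by fun_prop) 0) nhdsWithin_le_nhds
  rw [zero_mul, add_zero] at hT
  refine ge_of_tendsto hT ?_
  filter_upwards [Ioc_mem_nhdsGT (zero_lt_one (α := ℝ))] with t ht using key t ht.1 ht.2

theorem prox_firm {m : ℕ} {φ : En m → EReal} (hφ : ProperLscConvex φ)
    {c : ℝ} (hc : 0 < c) {p : En m → En m} (hp : IsProx φ c p) (z w : En m) :
    ‖p w - p z‖ ^ 2 ≤ ⟪w - z, p w - p z⟫ := by
  have h1 := prox_sub hφ hc hp z w
  have h2 := prox_sub hφ hc hp w z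
  have h3 : 0 ≤ c * (⟪p z - z, p w - p z⟫ + ⟪p w - w, p z - p w⟫) := by linarith
  have h4 := nonneg_of_mul_nonneg_right h3 hc
  rw [← real_inner_self_eq_norm_sq]
  simp only [inner_sub_left, inner_sub_right] at h4 ⊢
  linarith

theorem prox_lip {m : ℕ} {φ : En m → EReal} (hφ : ProperLscConvex φ)
    {c : ℝ} (hc : 0 < c) {p : En m → En m} (hp : IsProx φ c p) : LipschitzWith 1 p := by
  refine LipschitzWith.of_dist_le_mul fun w z => ?_
  rw [dist_eq_norm, dist_eq_norm, NNReal.coe_one, one_mul]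
  have h := (prox_firm hφ hc hp z w).trans (real_inner_le_norm _ _)
  rcases (norm_nonneg (p w - p z)).eq_or_lt with h0 | h0
  · rw [← h0]; positivity
  · refine le_of_mul_le_mul_right ?_ h0
    linarith

/-- the potential of the proximal map -/
def hpot {m : ℕ} (φ : En m → EReal) (c : ℝ) (p : En m → En m) (z : En m) : ℝ :=
  ⟪z, p z⟫ - ‖p z‖ ^ 2 / 2 - (φ (p z)).toReal / c

theorem hpot_sub {m : ℕ} {φ : En m → EReal} (hφ : ProperLscConvex φ)
    {c : ℝ} (hc : 0 < c) {p : En m → En m} (hp : IsProx φ c p) (z w : En m) :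
    hpot φ c p w + ⟪z - w, p w⟫ ≤ hpot φ c p z := by
  have h := prox_opt hφ hp z w
  rw [norm_sub_sq_real, norm_sub_sq_real] at h
  unfold hpot
  have e1 : (φ (p z)).toReal = c * ((φ (p z)).toReal / c) := by field_simp
  have e2 : (φ (p w)).toReal = c * ((φ (p w)).toReal / c) := by field_simp
  rw [e1, e2] at h
  rw [inner_sub_left, real_inner_comm (p z) z, real_inner_comm (p w) z]
  rw [real_inner_comm z (p z), real_inner_comm z (p w)]
  have : 0 ≤ c * ((φ (p w)).toReal / c + ‖p w‖ ^ 2 / 2 - ⟪p w, z⟫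
    - ((φ (p z)).toReal / c + ‖p z‖ ^ 2 / 2 - ⟪p z, z⟫)) := by linarith
  have := nonneg_of_mul_nonneg_right this hc
  linarith [real_inner_comm (p z) z, real_inner_comm (p w) z]

theorem hpot_deriv {m : ℕ} {φ : En m → EReal} (hφ : ProperLscConvex φ)
    {c : ℝ} (hc : 0 < c) {p : En m → En m} (hp : IsProx φ c p) (z : En m) :
    HasFDerivAt (hpot φ c p) (innerSL ℝ (p z)) z := by
  rw [hasFDerivAt_iff_isLittleO]
  have hO : (fun w => hpot φ c p w - hpot φ c p z - innerSL ℝ (p z) (w - z)) =O[𝓝 z]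
      fun w => ‖w - z‖ ^ 2 := by
    refine Asymptotics.IsBigO.of_bound 1 (Eventually.of_forall fun w => ?_)
    have h1 := hpot_sub hφ hc hp z w
    have h2 := hpot_sub hφ hc hp w z
    have h3 : ⟪w - z, p w - p z⟫ ≤ ‖w - z‖ ^ 2 := by
      have := (prox_lip hφ hc hp).dist_le_mul w z
      rw [dist_eq_norm, dist_eq_norm, NNReal.coe_one, one_mul] at this
      have := mul_le_mul_of_nonneg_left this (norm_nonneg (w - z))
      nlinarith [real_inner_le_norm (w - z) (p w - p z)]
    rw [inner_sub_right] at h3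
    have h4 : ⟪z - w, p w⟫ = - ⟪w - z, p w⟫ := by rw [← inner_neg_left, neg_sub]
    rw [innerSL_apply_apply, real_inner_comm, one_mul, Real.norm_eq_abs, Real.norm_eq_abs,
      abs_of_nonneg (by positivity : 0 ≤ ‖w - z‖ ^ 2), abs_le]
    constructor <;> nlinarith [sq_nonneg ‖w - z‖]
  exact hO.trans_isLittleO (Asymptotics.isLittleO_pow_sub_sub z one_lt_two)

theorem prox_fderiv {m : ℕ} {φ : En m → EReal} (hφ : ProperLscConvex φ)
    {c : ℝ} (hc : 0 < c) {p : En m → En m} (hp : IsProx φ c p) (x : En m)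
    (hx : DifferentiableAt ℝ p x) :
    SymCLM (fderiv ℝ p x) ∧ (∀ u : En m, 0 ≤ ⟪u, fderiv ℝ p x u⟫) ∧ ‖fderiv ℝ p x‖ ≤ 1 := by
  refine ⟨fun u v => ?_, fun u => ?_, ?_⟩
  · have h := second_derivative_symmetric (𝕜 := ℝ) (hpot_deriv hφ hc hp)
      (((innerSL ℝ : En m →L[ℝ] En m →L[ℝ] ℝ).hasFDerivAt (x := p x)).comp x hx.hasFDerivAt) u v
    have h' : ⟪fderiv ℝ p x u, v⟫ = ⟪fderiv ℝ p x v, u⟫ := h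
    rw [h', real_inner_comm]
  · have h := (hx.hasFDerivAt.hasLineDerivAt u).tendsto_slope_zero
    have h2 := (tendsto_const_nhds (x := u)).inner (𝕜 := ℝ) h
    refine ge_of_tendsto h2 ?_
    filter_upwards [self_mem_nhdsWithin] with t ht
    have h3 := prox_firm hφ hc hp x (x + t • u)
    rw [add_sub_cancel_left, inner_smul_left] at h3
    simp only [conj_trivial] at h3
    have ht' : t ≠ 0 := ht
    rw [inner_smul_right]
    have e : t⁻¹ * ⟪u, p (x + t • u) - p x⟫
      = (t⁻¹) ^ 2 * (t * ⟪u, p (x + t • u) - p x⟫) := by field_simp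
    rw [e]
    have := (sq_nonneg _).trans h3
    positivity
  · simpa using norm_fderiv_le_of_lipschitz ℝ (x₀ := x) (prox_lip hφ hc hp)

/-- Lemma 4.1 of the paper. Every element of the Clarke
generalized Jacobian of `prox_{φ/c}` is symmetric positive semidefinite with
operator norm at most `1`. -/
theorem clarkeJac_prox_psd_norm_le_one {m : ℕ}
    (φ : En m → EReal) (hφ : ProperLscConvex φ)
    (c : ℝ) (hc : 0 < c) (p : En m → En m) (hp : IsProx φ c p)
    (z : En m) (G : En m →L[ℝ] En m) (hG : G ∈ clarkeJac p z) :
    SymCLM G ∧ (∀ u : En m, 0 ≤ ⟪u, G u⟫) ∧ ‖G‖ ≤ 1 := by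
  have hconv : Convex ℝ {A : En m →L[ℝ] En m |
      SymCLM A ∧ (∀ u : En m, 0 ≤ ⟪u, A u⟫) ∧ ‖A‖ ≤ 1} := by
    rintro A ⟨a1, a2, a3⟩ B ⟨b1, b2, b3⟩ s t hs ht hst
    refine ⟨fun u v => ?_, fun u => ?_, ?_⟩
    · simp only [ContinuousLinearMap.add_apply, ContinuousLinearMap.smul_apply, inner_add_left,
        inner_add_right, real_inner_smul_left, real_inner_smul_right, a1 u v, b1 u v]
    · simp only [ContinuousLinearMap.add_apply, ContinuousLinearMap.smul_apply,
        inner_add_right, real_inner_smul_right]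
      have := a2 u
      have := b2 u
      positivity
    · have h := convex_closedBall (0 : En m →L[ℝ] En m) 1
        (mem_closedBall_zero_iff.2 a3) (mem_closedBall_zero_iff.2 b3) hs ht hst
      exact mem_closedBall_zero_iff.1 h
  refine convexHull_min ?_ hconv hG
  rintro A ⟨u, hu, -, hA⟩
  have hk := fun k => prox_fderiv hφ hc hp (u k) (hu k)
  have happ : ∀ v : En m, Tendsto (fun k => fderiv ℝ p (u k) v) atTop (𝓝 (A v)) :=
    fun v => ((ContinuousLinearMap.apply ℝ (En m) v).continuous.tendsto A).comp hA
  refine ⟨fun v w => ?_, fun v => ?_, ?_⟩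
  · refine tendsto_nhds_unique ((happ v).inner (𝕜 := ℝ) (tendsto_const_nhds (x := w))) ?_
    simp only [fun k => (hk k).1 v w]
    exact (tendsto_const_nhds (x := v)).inner (happ w)
  · exact ge_of_tendsto' ((tendsto_const_nhds (x := v)).inner (𝕜 := ℝ) (happ v))
      fun k => (hk k).2.1 v
  · exact le_of_tendsto' hA.norm fun k => (hk k).2.2
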